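/- Let (E, {f_i}_{i=1}^m) ∈ 𝓔 with convex hull I. If f_1(I) ∩ f_2(I) ≠ ∅ and f_{m−1}(I) ∩ f_m(I) ≠ ∅, then for every integer k ≥ 1, dim_H U_k(E) ≥ dim_H U_1(E). -/

import Mathlib

open Set Filter MeasureTheory

/-- A self-similar iterated function system on `ℝ` given by `m` similitudes
`f i x = r i * x + t i` (for `1 ≤ i ≤ m`, `m ≥ 3`), together with its attractor `E`:
the unique nonempty compact set with `E = ⋃_{i=1}^m f_i(E)`. -/
structure ClassE where
  m : ℕ
  r : ℕ → ℝ
  t : ℕ → ℝ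
  E : Set ℝ
  hm : 3 ≤ m
  hr : ∀ i, 1 ≤ i → i ≤ m → 0 < r i ∧ r i < 1
  hEne : E.Nonempty
  hEcpt : IsCompact E
  hEinv : E = ⋃ i ∈ Finset.Icc 1 m, (fun x => r i * x + t i) '' E

namespace ClassE

/-- The `i`-th similitude. -/
def f (S : ClassE) (i : ℕ) (x : ℝ) : ℝ := S.r i * x + S.t i

/-- Left endpoint `a` of the convex hull of `E`. -/
noncomputable def a (S : ClassE) : ℝ := sInf S.E

/-- Right endpoint `b` of the convex hull of `E`. -/
noncomputable def b (S : ClassE) : ℝ := sSup S.E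

/-- The convex hull `I = [a, b]` of `E`. -/
noncomputable def I (S : ClassE) : Set ℝ := Set.Icc S.a S.b

/-- Condition (A): `a = f_1(a) < f_2(a) < ⋯ < f_m(a) < f_m(b) = b`. -/
def condA (S : ClassE) : Prop :=
  S.f 1 S.a = S.a ∧ (∀ i, 1 ≤ i → i < S.m → S.f i S.a < S.f (i + 1) S.a) ∧
    S.f S.m S.a < S.f S.m S.b ∧ S.f S.m S.b = S.b

/-- Condition (B): `f_i(I) ∩ f_{i+2}(I) = ∅` for all `1 ≤ i ≤ m - 2`. -/
def condB (S : ClassE) : Prop :=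
  ∀ i, 1 ≤ i → i + 2 ≤ S.m → S.f i '' S.I ∩ S.f (i + 2) '' S.I = ∅

/-- Condition (C): there are `i, j ∈ {1, …, m-1}` with `f_i(I) ∩ f_{i+1}(I) = ∅` and
`f_j(I) ∩ f_{j+1}(I) ≠ ∅`. -/
def condC (S : ClassE) : Prop :=
  (∃ i, 1 ≤ i ∧ i + 1 ≤ S.m ∧ S.f i '' S.I ∩ S.f (i + 1) '' S.I = ∅) ∧
    (∃ j, 1 ≤ j ∧ j + 1 ≤ S.m ∧ S.f j '' S.I ∩ S.f (j + 1) '' S.I ≠ ∅)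

/-- Condition (D): whenever `f_i(I) ∩ f_{i+1}(I) ≠ ∅` there are `u, v ≥ 1` with
`f_i(I) ∩ f_{i+1}(I) = f_i ∘ f_m^u (I) = f_{i+1} ∘ f_1^v (I)`. -/
def condD (S : ClassE) : Prop :=
  ∀ i, 1 ≤ i → i + 1 ≤ S.m → S.f i '' S.I ∩ S.f (i + 1) '' S.I ≠ ∅ →
    ∃ u v : ℕ, 1 ≤ u ∧ 1 ≤ v ∧
      S.f i '' S.I ∩ S.f (i + 1) '' S.I = (S.f i ∘ (S.f S.m)^[u]) '' S.I ∧
      S.f i '' S.I ∩ S.f (i + 1) '' S.I = (S.f (i + 1) ∘ (S.f 1)^[v]) '' S.I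

/-- Membership in the class `𝓔`: conditions (A)–(D). -/
def goodE (S : ClassE) : Prop := S.condA ∧ S.condB ∧ S.condC ∧ S.condD

/-- `prefixMap d n = f_{d 0} ∘ f_{d 1} ∘ ⋯ ∘ f_{d (n-1)}`. -/
def prefixMap (S : ClassE) (d : ℕ → ℕ) : ℕ → ℝ → ℝ
  | 0 => id
  | n + 1 => S.prefixMap d n ∘ S.f (d n)

/-- `d : ℕ → ℕ` (with digits in `{1, …, m}`) is a coding of `x` if
`x = lim_n f_{d 0} ∘ ⋯ ∘ f_{d (n-1)} (0)`. -/
def isCoding (S : ClassE) (d : ℕ → ℕ) (x : ℝ) : Prop :=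
  (∀ n, 1 ≤ d n ∧ d n ≤ S.m) ∧
    Tendsto (fun n => S.prefixMap d n 0) atTop (nhds x)

/-- The set of codings of `x`. -/
def codings (S : ClassE) (x : ℝ) : Set (ℕ → ℕ) := {d | S.isCoding d x}

/-- `U k E`: the set of points of `E` having exactly `k` distinct codings
(`k` a cardinal; e.g. `k = ℵ₀` for countably infinitely many codings,
`k = 𝔠 = 2^ℵ₀` for a continuum of codings). -/
def U (S : ClassE) (k : Cardinal) : Set ℝ :=
  {x ∈ S.E | Cardinal.mk (S.codings x) = k}

end ClassE


namespace ClassE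

lemma aux_f_lt (S : ClassE) {i : ℕ} (h1 : 1 ≤ i) (h2 : i ≤ S.m) {x y : ℝ} (h : x < y) :
    S.f i x < S.f i y := by
  have := (S.hr i h1 h2).1
  unfold f
  nlinarith [mul_lt_mul_of_pos_left h this]

lemma aux_f_mono (S : ClassE) {i : ℕ} (h1 : 1 ≤ i) (h2 : i ≤ S.m) : StrictMono (S.f i) :=
  fun _ _ h => S.aux_f_lt h1 h2 h

lemma aux_f_inj (S : ClassE) {i : ℕ} (h1 : 1 ≤ i) (h2 : i ≤ S.m) : Function.Injective (S.f i) :=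
  (S.aux_f_mono h1 h2).injective

lemma aux_fE (S : ClassE) {i : ℕ} (h1 : 1 ≤ i) (h2 : i ≤ S.m) {x : ℝ} (hx : x ∈ S.E) :
    S.f i x ∈ S.E := by
  rw [S.hEinv]
  simp only [mem_iUnion]
  exact ⟨i, Finset.mem_Icc.2 ⟨h1, h2⟩, x, hx, rfl⟩

lemma aux_E_I (S : ClassE) {x : ℝ} (hx : x ∈ S.E) : x ∈ S.I :=
  ⟨csInf_le S.hEcpt.bddBelow hx, le_csSup S.hEcpt.bddAbove hx⟩

lemma aux_aE (S : ClassE) : S.a ∈ S.E := S.hEcpt.sInf_mem S.hEne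
lemma aux_bE (S : ClassE) : S.b ∈ S.E := S.hEcpt.sSup_mem S.hEne

lemma aux_fI (S : ClassE) {i : ℕ} (h1 : 1 ≤ i) (h2 : i ≤ S.m) {x : ℝ} (hx : x ∈ S.I) :
    S.f i x ∈ S.I :=
  ⟨(S.aux_E_I (S.aux_fE h1 h2 S.aux_aE)).1.trans ((S.aux_f_mono h1 h2).monotone hx.1),
   ((S.aux_f_mono h1 h2).monotone hx.2).trans (S.aux_E_I (S.aux_fE h1 h2 S.aux_bE)).2⟩

lemma aux_iterI (S : ClassE) {i : ℕ} (h1 : 1 ≤ i) (h2 : i ≤ S.m) (n : ℕ) {x : ℝ} (hx : x ∈ S.I) :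
    (S.f i)^[n] x ∈ S.I := by
  induction n with
  | zero => exact hx
  | succ n ih => rw [Function.iterate_succ_apply']; exact S.aux_fI h1 h2 ih

lemma aux_iterE (S : ClassE) {i : ℕ} (h1 : 1 ≤ i) (h2 : i ≤ S.m) (n : ℕ) {x : ℝ} (hx : x ∈ S.E) :
    (S.f i)^[n] x ∈ S.E := by
  induction n with
  | zero => exact hx
  | succ n ih => rw [Function.iterate_succ_apply']; exact S.aux_fE h1 h2 ih

lemma aux_image_I (S : ClassE) {i : ℕ} (h1 : 1 ≤ i) (h2 : i ≤ S.m) {x : ℝ}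
    (hl : S.f i S.a ≤ x) (hu : x ≤ S.f i S.b) : x ∈ S.f i '' S.I := by
  have hr := (S.hr i h1 h2).1
  refine ⟨(x - S.t i) / S.r i, ⟨?_, ?_⟩, ?_⟩
  · rw [le_div_iff₀ hr]; unfold f at hl; linarith
  · rw [div_le_iff₀ hr]; unfold f at hu; linarith
  · unfold f; field_simp; ring

lemma aux_chain (S : ClassE) (hA : S.condA) {i : ℕ} (h1 : 1 ≤ i) (n : ℕ) (h : i + n ≤ S.m) :
    S.f i S.a ≤ S.f (i + n) S.a := by
  induction n with
  | zero => simp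
  | succ n ih => exact (ih (by omega)).trans (hA.2.1 (i + n) (by omega) (by omega)).le

lemma aux_sep (S : ClassE) (hA : S.condA) (hB : S.condB) {i j : ℕ} (h1 : 1 ≤ i) (hij : i < j)
    (hj : j ≤ S.m) {x : ℝ} (hx : x ∈ S.f i '' S.I) (hy : x ∈ S.f j '' S.I) : j = i + 1 := by
  by_contra hne
  obtain ⟨n, rfl⟩ : ∃ n, j = (i + 2) + n := ⟨j - (i + 2), by omega⟩
  have hc := S.aux_chain hA (i := i + 2) (by omega) n hj
  have hc0 := S.aux_chain hA h1 2 (by omega)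
  obtain ⟨y, hy, rfl⟩ := hx
  obtain ⟨z, hz, hzy⟩ := hy
  have e1 : S.f (i + 2 + n) S.a ≤ S.f (i+2+n) z := (S.aux_f_mono (by omega) hj).monotone hz.1
  have e2 : S.f i y ≤ S.f i S.b := (S.aux_f_mono h1 (by omega)).monotone hy.2
  have hm : S.f (i+2) S.a ∈ S.f i '' S.I ∩ S.f (i + 2) '' S.I :=
    ⟨S.aux_image_I h1 (by omega) hc0 (by linarith), ⟨S.a, S.aux_E_I S.aux_aE, rfl⟩⟩
  rw [hB i h1 (by omega)] at hm
  exact hm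

/-- overlap on the right -/
lemma aux_ovr (S : ClassE) (hD : S.condD) {i : ℕ} (h1 : 1 ≤ i) (hi : i + 1 ≤ S.m) {y : ℝ}
    (hy : y ∈ S.I) (h : S.f i y ∈ S.f (i + 1) '' S.I) : y ∈ S.f S.m '' S.I := by
  have hm : S.f i y ∈ S.f i '' S.I ∩ S.f (i + 1) '' S.I := ⟨⟨y, hy, rfl⟩, h⟩
  obtain ⟨u, v, hu, hv, e1, e2⟩ := hD i h1 hi (Set.Nonempty.ne_empty ⟨_, hm⟩)
  rw [e1] at hm
  obtain ⟨z, hz, hzy⟩ := hm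
  obtain ⟨u, rfl⟩ : ∃ u', u = u' + 1 := ⟨u - 1, by omega⟩
  have := S.aux_f_inj h1 (by omega) hzy
  rw [← this, Function.iterate_succ_apply']
  exact ⟨_, S.aux_iterI (by omega) le_rfl _ hz, rfl⟩

lemma aux_ovl (S : ClassE) (hD : S.condD) {i : ℕ} (h1 : 1 ≤ i) (hi : i + 1 ≤ S.m) {y : ℝ}
    (hy : y ∈ S.I) (h : S.f (i + 1) y ∈ S.f i '' S.I) : y ∈ S.f 1 '' S.I := by
  have hm : S.f (i + 1) y ∈ S.f i '' S.I ∩ S.f (i + 1) '' S.I := ⟨h, ⟨y, hy, rfl⟩⟩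
  obtain ⟨u, v, hu, hv, e1, e2⟩ := hD i h1 hi (Set.Nonempty.ne_empty ⟨_, hm⟩)
  rw [e2] at hm
  obtain ⟨z, hz, hzy⟩ := hm
  obtain ⟨v, rfl⟩ : ∃ u', v = u' + 1 := ⟨v - 1, by omega⟩
  have := S.aux_f_inj (by omega) hi hzy
  rw [← this, Function.iterate_succ_apply']
  exact ⟨_, S.aux_iterI (by omega) (by omega) _ hz, rfl⟩

/-- Affine increasing maps. -/
def Aff (F : ℝ → ℝ) : Prop := ∃ p q : ℝ, 0 < p ∧ ∀ x, F x = p * x + q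

lemma aff_f (S : ClassE) {i : ℕ} (h1 : 1 ≤ i) (h2 : i ≤ S.m) : Aff (S.f i) :=
  ⟨S.r i, S.t i, (S.hr i h1 h2).1, fun _ => rfl⟩

lemma aff_comp {F G : ℝ → ℝ} (hF : Aff F) (hG : Aff G) : Aff (F ∘ G) := by
  obtain ⟨p, q, hp, h⟩ := hF
  obtain ⟨p', q', hp', h'⟩ := hG
  exact ⟨p * p', p * q' + q, by positivity, fun x => by simp only [Function.comp, h, h']; ring⟩

lemma aff_iter {F : ℝ → ℝ} (hF : Aff F) (n : ℕ) : Aff (F^[n]) := by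
  induction n with
  | zero => exact ⟨1, 0, one_pos, fun x => by simp⟩
  | succ n ih => rw [Function.iterate_succ]; exact aff_comp ih hF

lemma aff_mono {F : ℝ → ℝ} (hF : Aff F) : Monotone F := by
  obtain ⟨p, q, hp, h⟩ := hF
  intro x y hxy
  rw [h, h]
  have := mul_le_mul_of_nonneg_left hxy hp.le
  linarith

lemma aff_eq {F G : ℝ → ℝ} (hF : Aff F) (hG : Aff G) {a b : ℝ} (hab : a < b)
    (h : F '' Icc a b = G '' Icc a b) : F = G := by
  have key : ∀ {F G : ℝ → ℝ}, Aff F → Aff G → F '' Icc a b = G '' Icc a b →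
      G a ≤ F a ∧ F b ≤ G b := by
    intro F G hF hG h
    constructor
    · have : F a ∈ G '' Icc a b := h ▸ ⟨a, ⟨le_rfl, hab.le⟩, rfl⟩
      obtain ⟨z, hz, e⟩ := this
      rw [← e]; exact aff_mono hG hz.1
    · have : F b ∈ G '' Icc a b := h ▸ ⟨b, ⟨hab.le, le_rfl⟩, rfl⟩
      obtain ⟨z, hz, e⟩ := this
      rw [← e]; exact aff_mono hG hz.2
  have k1 := key hF hG h
  have k2 := key hG hF h.symm
  have ea : F a = G a := le_antisymm k2.1 k1.1
  have eb : F b = G b := le_antisymm k1.2 k2.2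
  obtain ⟨p, q, hp, hF⟩ := hF
  obtain ⟨p', q', hp', hG⟩ := hG
  rw [hF, hG] at ea eb
  have : (p - p') * (b - a) = 0 := by linarith
  have hpp : p = p' := by
    rcases mul_eq_zero.1 this with h | h <;> linarith
  subst hpp
  funext x
  rw [hF, hG]; linarith

lemma aff_dim {F : ℝ → ℝ} (hF : Aff F) (s : Set ℝ) : dimH s ≤ dimH (F '' s) := by
  obtain ⟨p, q, hp, h⟩ := hF
  have hanti : AntilipschitzWith (Real.toNNReal p⁻¹) F := by
    refine AntilipschitzWith.of_le_mul_dist fun x y => ?_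
    rw [Real.coe_toNNReal _ (by positivity), h, h, Real.dist_eq, Real.dist_eq,
      show p * x + q - (p * y + q) = p * (x - y) by ring, abs_mul, abs_of_pos hp,
      ← mul_assoc, inv_mul_cancel₀ hp.ne', one_mul]
  exact hanti.le_dimH_image s

/-- cons of a digit -/
def consd (i : ℕ) (d : ℕ → ℕ) : ℕ → ℕ
  | 0 => i
  | n + 1 => d n

lemma consd_inj (i : ℕ) : Function.Injective (consd i) := by
  intro d e h
  funext n
  exact congrFun h (n + 1)

lemma consd_tail (d : ℕ → ℕ) : consd (d 0) (fun n => d (n + 1)) = d := by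
  funext n; cases n <;> rfl

lemma prefix_cons (S : ClassE) (i : ℕ) (d : ℕ → ℕ) (n : ℕ) :
    S.prefixMap (consd i d) (n + 1) = S.f i ∘ S.prefixMap d n := by
  induction n with
  | zero => rfl
  | succ n ih =>
    change S.prefixMap (consd i d) (n + 1) ∘ S.f (d n) = _
    rw [ih]; rfl

lemma coding_cons (S : ClassE) {i : ℕ} (h1 : 1 ≤ i) (h2 : i ≤ S.m) (d : ℕ → ℕ) (y : ℝ) :
    S.isCoding (consd i d) (S.f i y) ↔ S.isCoding d y := by
  have hr := (S.hr i h1 h2).1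
  have hc : Continuous (S.f i) := by unfold f; fun_prop
  unfold isCoding
  refine and_congr ?_ ?_
  · constructor
    · intro h n; exact h (n + 1)
    · rintro h (_ | n)
      · exact ⟨h1, h2⟩
      · exact h n
  · rw [← tendsto_add_atTop_iff_nat 1]
    simp only [prefix_cons, Function.comp]
    constructor
    · intro h
      have hc' : Continuous (fun x => (x - S.t i) / S.r i) := by fun_prop
      have := (hc'.tendsto _).comp h
      have e : ∀ x, (S.f i x - S.t i) / S.r i = x := by
        intro x; unfold f; field_simp; ring
      simpa only [Function.comp_def, e] using this
    · intro h
      exact (hc.tendsto _).comp h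

lemma coding_E (S : ClassE) {d : ℕ → ℕ} {x : ℝ} (h : S.isCoding d x) : x ∈ S.E := by
  obtain ⟨hd, hl⟩ := h
  obtain ⟨R, hR0, hR1, hR⟩ : ∃ R : ℝ, 0 ≤ R ∧ R < 1 ∧ ∀ i, 1 ≤ i → i ≤ S.m → S.r i ≤ R := by
    have hne : (Finset.Icc 1 S.m).Nonempty := ⟨1, Finset.mem_Icc.2 ⟨le_rfl, by have := S.hm; omega⟩⟩
    obtain ⟨j, hj, hjm⟩ := Finset.exists_max_image (Finset.Icc 1 S.m) S.r hne
    have hj := Finset.mem_Icc.1 hj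
    exact ⟨S.r j, (S.hr j hj.1 hj.2).1.le, (S.hr j hj.1 hj.2).2,
      fun i h1 h2 => hjm i (Finset.mem_Icc.2 ⟨h1, h2⟩)⟩
  have hdiff : ∀ n, ∀ x y, |S.prefixMap d n x - S.prefixMap d n y| ≤ R ^ n * |x - y| := by
    intro n
    induction n with
    | zero => intro x y; simp [prefixMap]
    | succ n ih =>
      intro x y
      refine (ih _ _).trans ?_
      have h1 := hR (d n) (hd n).1 (hd n).2
      have h0 := (S.hr (d n) (hd n).1 (hd n).2).1
      rw [pow_succ, mul_assoc]
      gcongr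
      rw [show S.f (d n) x - S.f (d n) y = S.r (d n) * (x - y) by unfold f; ring, abs_mul,
        abs_of_pos h0]
      gcongr
  have hmem : ∀ n, ∀ x ∈ S.E, S.prefixMap d n x ∈ S.E := by
    intro n
    induction n with
    | zero => intro x hx; exact hx
    | succ n ih => intro x hx; exact ih _ (S.aux_fE (hd n).1 (hd n).2 hx)
  have hz : Tendsto (fun n => S.prefixMap d n S.a - S.prefixMap d n 0) atTop (nhds 0) := by
    refine squeeze_zero_norm (a := fun n => R ^ n * |S.a - 0|) (fun n => hdiff n _ _) ?_
    simpa using (tendsto_pow_atTop_nhds_zero_of_lt_one hR0 hR1).mul_const (|S.a - 0|)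
  have := hz.add hl
  simp only [sub_add_cancel, zero_add] at this
  exact S.hEcpt.isClosed.mem_of_tendsto this (Eventually.of_forall fun n => hmem n _ S.aux_aE)

/-- the first digit -/
lemma coding_head (S : ClassE) {d : ℕ → ℕ} {x : ℝ} (h : S.isCoding d x) :
    ∃ e y, y ∈ S.I ∧ S.isCoding e y ∧ x = S.f (d 0) y ∧ d = consd (d 0) e := by
  have hd := h.1 0
  have hr := (S.hr (d 0) hd.1 hd.2).1
  have e : S.f (d 0) ((x - S.t (d 0)) / S.r (d 0)) = x := by
    unfold f; field_simp; ring
  have hc : S.isCoding (fun n => d (n + 1)) ((x - S.t (d 0)) / S.r (d 0)) := by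
    rw [← S.coding_cons hd.1 hd.2, e, consd_tail]; exact h
  exact ⟨_, _, S.aux_E_I (S.coding_E hc), hc, e.symm, (consd_tail d).symm⟩

lemma codings_single (S : ClassE) (hA : S.condA) (hB : S.condB) (hD : S.condD) {i : ℕ}
    (h1 : 1 ≤ i) (h2 : i ≤ S.m) {y : ℝ} (hy : y ∈ S.I)
    (hl : ∀ j, 1 ≤ j → j + 1 = i → y ∉ S.f 1 '' S.I ∨ S.f j '' S.I ∩ S.f (j + 1) '' S.I = ∅)
    (hr : i + 1 ≤ S.m → y ∉ S.f S.m '' S.I ∨ S.f i '' S.I ∩ S.f (i + 1) '' S.I = ∅) :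
    (∀ j, 1 ≤ j → j ≤ S.m → S.f i y ∈ S.f j '' S.I → j = i) ∧
    Cardinal.mk (S.codings (S.f i y)) = Cardinal.mk (S.codings y) := by
  have hu : ∀ j, 1 ≤ j → j ≤ S.m → S.f i y ∈ S.f j '' S.I → j = i := by
    intro j hj1 hj2 hj
    have hi : S.f i y ∈ S.f i '' S.I := ⟨y, hy, rfl⟩
    rcases lt_trichotomy j i with h | h | h
    · have := S.aux_sep hA hB hj1 h h2 hj hi
      subst this
      rcases hl j hj1 rfl with h' | h'
      · exact absurd (S.aux_ovl hD hj1 h2 hy hj) h'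
      · exact (Set.eq_empty_iff_forall_notMem.1 h' _ ⟨hj, hi⟩).elim
    · exact h
    · have := S.aux_sep hA hB h1 h hj2 hi hj
      subst this
      rcases hr hj2 with h' | h'
      · exact absurd (S.aux_ovr hD h1 hj2 hy hj) h'
      · exact (Set.eq_empty_iff_forall_notMem.1 h' _ ⟨hi, hj⟩).elim
  refine ⟨hu, ?_⟩
  have : S.codings (S.f i y) = consd i '' S.codings y := by
    ext d
    constructor
    · intro h
      obtain ⟨e, z, hz, he, hx, hde⟩ := S.coding_head h
      have hd := h.1 0
      have := hu (d 0) hd.1 hd.2 (hx ▸ ⟨z, hz, rfl⟩)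
      rw [this] at hde hx
      have := S.aux_f_inj h1 h2 hx
      subst this
      exact ⟨e, he, hde.symm⟩
    · rintro ⟨e, he, rfl⟩
      exact (S.coding_cons h1 h2 e y).2 he
  rw [this, Cardinal.mk_image_eq (consd_inj i)]

lemma not_1_m (S : ClassE) (hA : S.condA) (hB : S.condB) {x : ℝ}
    (h1 : x ∈ S.f 1 '' S.I) (h2 : x ∈ S.f S.m '' S.I) : False := by
  have := S.hm
  have := S.aux_sep hA hB le_rfl (by omega) le_rfl h1 h2
  omega

lemma card_m (S : ClassE) (hA : S.condA) (hB : S.condB) (hD : S.condD) {z : ℝ} (hz : z ∈ S.I)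
    (h : z ∉ S.f 1 '' S.I) (n : ℕ) : (S.f S.m)^[n] z ∉ S.f 1 '' S.I ∧
    Cardinal.mk (S.codings ((S.f S.m)^[n] z)) = Cardinal.mk (S.codings z) := by
  have hm := S.hm
  induction n with
  | zero => exact ⟨h, rfl⟩
  | succ n ih =>
    have hI := S.aux_iterI (i := S.m) (by omega) le_rfl n hz
    rw [Function.iterate_succ_apply', ← ih.2]
    exact ⟨fun h' => S.not_1_m hA hB h' ⟨_, hI, rfl⟩,
      (S.codings_single hA hB hD (by omega) le_rfl hI (fun _ _ _ => Or.inl ih.1)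
        (fun h => by omega)).2⟩

lemma card_1 (S : ClassE) (hA : S.condA) (hB : S.condB) (hD : S.condD) {z : ℝ} (hz : z ∈ S.I)
    (h : z ∉ S.f S.m '' S.I) (n : ℕ) : (S.f 1)^[n] z ∉ S.f S.m '' S.I ∧
    Cardinal.mk (S.codings ((S.f 1)^[n] z)) = Cardinal.mk (S.codings z) := by
  have hm := S.hm
  induction n with
  | zero => exact ⟨h, rfl⟩
  | succ n ih =>
    have hI := S.aux_iterI (i := 1) le_rfl (by omega) n hz
    rw [Function.iterate_succ_apply', ← ih.2]
    exact ⟨fun h' => S.not_1_m hA hB ⟨_, hI, rfl⟩ h',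
      (S.codings_single hA hB hD le_rfl (by omega) hI (fun _ _ _ => by omega)
        (fun h => Or.inl ih.1)).2⟩

lemma card_main (S : ClassE) (hA : S.condA) (hB : S.condB) (hD : S.condD) {u v : ℕ}
    (hv : 1 ≤ v) (huv : S.f 1 ∘ (S.f S.m)^[u] = S.f 2 ∘ (S.f 1)^[v])
    {z : ℝ} (hz : z ∈ S.I) (h1 : z ∉ S.f 1 '' S.I) (h2 : z ∉ S.f S.m '' S.I)
    (hc : Cardinal.mk (S.codings z) = 1) (j : ℕ) :
    Cardinal.mk (S.codings (S.f 1 ((S.f S.m)^[j * u] z))) = ((j + 1 : ℕ) : Cardinal) := by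
  have hm := S.hm
  induction j with
  | zero =>
    have := (S.card_1 hA hB hD hz h2 1).2
    simpa [hc] using this
  | succ j ih =>
    set w := (S.f S.m)^[j * u] z with hw
    have hwI : w ∈ S.I := S.aux_iterI (by omega) le_rfl _ hz
    have hit : (S.f S.m)^[(j + 1) * u] z = (S.f S.m)^[u] w := by
      rw [hw, ← Function.iterate_add_apply]; congr 2; ring
    have hc1 := (S.card_m hA hB hD hz h1 ((j + 1) * u)).2
    rw [hit, hc] at hc1
    rw [hit]
    obtain ⟨v, rfl⟩ : ∃ v', v = v' + 1 := ⟨v - 1, by omega⟩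
    have hf1w : S.f 1 w ∈ S.f 1 '' S.I := ⟨w, hwI, rfl⟩
    have hc2 := (S.card_1 hA hB hD (S.aux_fI (i := 1) le_rfl (by omega) hwI)
      (fun h => S.not_1_m hA hB hf1w h) v).2
    rw [ih, ← Function.iterate_succ_apply] at hc2
    have hx : S.f 1 ((S.f S.m)^[u] w) = S.f 2 ((S.f 1)^[v + 1] w) := congrFun huv w
    have hI1 : (S.f S.m)^[u] w ∈ S.I := S.aux_iterI (by omega) le_rfl _ hwI
    have hset : S.codings (S.f 1 ((S.f S.m)^[u] w)) =
        consd 1 '' S.codings ((S.f S.m)^[u] w) ∪ consd 2 '' S.codings ((S.f 1)^[v + 1] w) := by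
      ext d
      constructor
      · intro h
        obtain ⟨e, y, hy, he, hxy, hde⟩ := S.coding_head h
        have hd := h.1 0
        have hcase : d 0 = 1 ∨ d 0 = 2 := by
          by_contra hcon
          have := S.aux_sep hA hB (i := 1) (j := d 0) le_rfl (by omega) hd.2 ⟨_, hI1, rfl⟩
            (hxy ▸ ⟨y, hy, rfl⟩)
          omega
        rcases hcase with h0 | h0
        · left
          rw [h0] at hxy hde
          have := S.aux_f_inj le_rfl (by omega) hxy
          exact ⟨e, this ▸ he, hde.symm⟩
        · right
          rw [h0] at hxy hde
          rw [hx] at hxy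
          have := S.aux_f_inj (by omega) (by omega) hxy
          exact ⟨e, this ▸ he, hde.symm⟩
      · rintro (⟨e, he, rfl⟩ | ⟨e, he, rfl⟩)
        · exact (S.coding_cons le_rfl (by omega) e _).2 he
        · rw [hx]; exact (S.coding_cons (by omega) (by omega) e _).2 he
    have hdis : Disjoint (consd 1 '' S.codings ((S.f S.m)^[u] w))
        (consd 2 '' S.codings ((S.f 1)^[v + 1] w)) := by
      rw [Set.disjoint_left]
      rintro d ⟨e, _, rfl⟩ ⟨e', _, h⟩
      have := congrFun h 0
      simp [consd] at this
    rw [hset, Cardinal.mk_union_of_disjoint hdis, Cardinal.mk_image_eq (consd_inj 1),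
      Cardinal.mk_image_eq (consd_inj 2), hc1, hc2]
    push_cast
    ring

end ClassE

open ClassE

theorem stmt13 (S : ClassE) (hS : S.goodE)
    (h1 : S.f 1 '' S.I ∩ S.f 2 '' S.I ≠ ∅)
    (h2 : S.f (S.m - 1) '' S.I ∩ S.f S.m '' S.I ≠ ∅) :
    ∀ k : ℕ, 1 ≤ k → dimH (S.U 1) ≤ dimH (S.U k) := by
  intro k hk
  obtain ⟨hA, hB, ⟨⟨i, hi1, him, hgap⟩, -⟩, hD⟩ := hS
  have hm := S.hm
  have hab : S.a < S.b := by
    by_contra hcon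
    exact absurd hA.2.2.1 (not_lt.2 ((S.aux_f_mono (by omega) le_rfl).monotone (not_lt.1 hcon)))
  have hi2 : i ≠ 1 := by rintro rfl; exact h1 hgap
  have him2 : i + 1 ≠ S.m := by
    intro h
    apply h2
    have : S.m - 1 = i := by omega
    rw [this, ← h]; exact hgap
  obtain ⟨u, v, hu, hv, e1, e2⟩ := hD 1 le_rfl (by omega) h1
  have huv : S.f 1 ∘ (S.f S.m)^[u] = S.f 2 ∘ (S.f 1)^[v] :=
    aff_eq (aff_comp (S.aff_f le_rfl (by omega)) (aff_iter (S.aff_f (by omega) le_rfl) u))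
      (aff_comp (S.aff_f (by omega) (by omega)) (aff_iter (S.aff_f le_rfl (by omega)) v)) hab
      (e1.symm.trans e2)
  set Z : Set ℝ := {z | z ∈ S.U 1 ∧ z ∉ S.f 1 '' S.I ∧ z ∉ S.f S.m '' S.I} with hZ
  have hZk : dimH Z ≤ dimH (S.U k) := by
    have hF : Aff (S.f 1 ∘ (S.f S.m)^[(k - 1) * u]) :=
      aff_comp (S.aff_f le_rfl (by omega)) (aff_iter (S.aff_f (by omega) le_rfl) _)
    refine (aff_dim hF Z).trans (dimH_mono ?_)
    rintro _ ⟨z, ⟨⟨hzE, hz1⟩, hz2, hz3⟩, rfl⟩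
    refine ⟨S.aux_fE le_rfl (by omega) (S.aux_iterE (by omega) le_rfl _ hzE), ?_⟩
    have := S.card_main hA hB hD hv huv (S.aux_E_I hzE) hz2 hz3 hz1 (k - 1)
    rw [Nat.sub_add_cancel hk] at this
    exact this
  refine le_trans ?_ hZk
  have hsplit : S.U 1 = (S.U 1 \ S.f 1 '' S.I) ∪ (S.U 1 ∩ S.f 1 '' S.I) :=
    (sdiff_union_inter _ _).symm
  rw [hsplit, dimH_union]
  refine max_le ?_ ?_
  · refine (aff_dim (S.aff_f hi1 (by omega)) _).trans (dimH_mono ?_)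
    rintro _ ⟨x, ⟨⟨hxE, hx1⟩, hx⟩, rfl⟩
    have := S.codings_single hA hB hD hi1 (by omega) (S.aux_E_I hxE)
      (fun _ _ _ => Or.inl hx) (fun _ => Or.inr hgap)
    exact ⟨⟨S.aux_fE hi1 (by omega) hxE, this.2.trans hx1⟩,
      fun h => hi2 (this.1 1 le_rfl (by omega) h).symm,
      fun h => by have := this.1 S.m (by omega) le_rfl h; omega⟩
  · refine (aff_dim (S.aff_f (i := i + 1) (by omega) him) _).trans (dimH_mono ?_)
    rintro _ ⟨x, ⟨⟨hxE, hx1⟩, hx⟩, rfl⟩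
    have := S.codings_single hA hB hD (i := i + 1) (by omega) him (S.aux_E_I hxE)
      (fun j hj hji => Or.inr (by
        obtain rfl : j = i := by omega
        exact hgap)) (fun _ => Or.inl (fun h => S.not_1_m hA hB hx h))
    exact ⟨⟨S.aux_fE (by omega) him hxE, this.2.trans hx1⟩,
      fun h => by have := this.1 1 le_rfl (by omega) h; omega,
      fun h => by have := this.1 S.m (by omega) le_rfl h; omega⟩
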